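/- Let n ≥ 1, p > 2, and let Ω be the open unit ball of ℝⁿ. There exists u₀ ∈ X such that: (a) there is no classical solution of u_t − Δu = |∇u|^p with zero Dirichlet data and initial data u₀ on Ω̄ × [0,∞) (i.e., the maximal classical solution undergoes gradient blowup in finite time, T*(u₀) < ∞); and (b) for every family (u_j)_{j≥1} where each u_j is a classical solution of the j-th regularized problem with data u₀, for every x₀ ∈ ∂Ω and every t > 0, sup_{j≥1} u_j(x,t) → 0 as x → x₀ with x ∈ Ω (i.e., the global viscosity solution never loses the boundary conditions: it vanishes on ∂Ω × (0,∞)). -/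

import Mathlib

open Set Filter Metric MeasureTheory Topology
open scoped ENNReal

noncomputable section

/-- Euclidean space ℝⁿ. -/
abbrev Euc (n : ℕ) := EuclideanSpace ℝ (Fin n)

/-- Membership in the class `X` of `C¹(Ω̄)` functions that are nonnegative on `Ω̄`
and vanish on `∂Ω`. -/
def MemX {n : ℕ} (Ω : Set (Euc n)) (v : Euc n → ℝ) : Prop :=
  ContDiffOn ℝ 1 v (closure Ω) ∧ (∀ x ∈ closure Ω, 0 ≤ v x) ∧ ∀ x ∈ frontier Ω, v x = 0

/-- The regularized Hamiltonian `F_j(ξ) = min(|ξ|^p, j^{p-2}|ξ|²)`. -/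
def Fj (n : ℕ) (p : ℝ) (j : ℕ) (ξ : Euc n) : ℝ :=
  min (‖ξ‖ ^ p) ((j : ℝ) ^ (p - 2) * ‖ξ‖ ^ 2)

/-- The Laplacian, as the sum of the second partial derivatives. -/
def lap (n : ℕ) (f : Euc n → ℝ) (x : Euc n) : ℝ :=
  ∑ i : Fin n,
    fderiv ℝ (fun y => fderiv ℝ f y (EuclideanSpace.single i 1)) x (EuclideanSpace.single i 1)

/-- `u` is a classical solution of the `j`-th regularized problem
`∂ₜu = Δu + F_j(∇u)` in `Ω × (0,∞)`, `u = 0` on `∂Ω × (0,∞)`, `u(·,0) = u₀`. -/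
structure IsRegSol (n : ℕ) (p : ℝ) (Ω : Set (Euc n)) (j : ℕ) (u0 : Euc n → ℝ)
    (u : Euc n → ℝ → ℝ) : Prop where
  cont : ContinuousOn (fun q : Euc n × ℝ => u q.1 q.2) (closure Ω ×ˢ Ici (0:ℝ))
  nonneg : ∀ x ∈ closure Ω, ∀ t ∈ Ici (0:ℝ), 0 ≤ u x t
  time_reg : ∀ x ∈ Ω, ContDiffOn ℝ 1 (fun s => u x s) (Ioi (0:ℝ))
  space_reg : ∀ t ∈ Ioi (0:ℝ), ContDiffOn ℝ 2 (fun y => u y t) Ω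
  eqn : ∀ x ∈ Ω, ∀ t ∈ Ioi (0:ℝ),
    deriv (fun s => u x s) t = lap n (fun y => u y t) x + Fj n p j (gradient (fun y => u y t) x)
  bc : ∀ x ∈ frontier Ω, ∀ t ∈ Ioi (0:ℝ), u x t = 0
  ic : ∀ x ∈ closure Ω, u x 0 = u0 x

/-- The pointwise supremum `U(x,t) = sup_{j ≥ 1} u_j(x,t)` of a family of approximating
solutions; on `Ω × (0,∞)` this coincides with the global viscosity solution. -/
def Usup {n : ℕ} (u : ℕ → Euc n → ℝ → ℝ) (x : Euc n) (t : ℝ) : ℝ :=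
  ⨆ j : {j : ℕ // 1 ≤ j}, u j.1 x t

/-- The time interval `[0,T)` (as a subset of ℝ), `T ∈ (0,∞]`. -/
def TimeIcc (T : ℝ≥0∞) : Set ℝ := {t : ℝ | 0 ≤ t ∧ ENNReal.ofReal t < T}

/-- The time interval `(0,T)` (as a subset of ℝ), `T ∈ (0,∞]`. -/
def TimeIoo (T : ℝ≥0∞) : Set ℝ := {t : ℝ | 0 < t ∧ ENNReal.ofReal t < T}

/-- `u` is a classical solution of the Dirichlet problem `∂ₜu = Δu + |∇u|^p` in `Ω × (0,T)`,
`u = 0` on `∂Ω × [0,T)`, `u(·,0) = u₀`, with `u` and `∇u` continuous on `Ω̄ × [0,T)`. -/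
structure IsClassicalSol (n : ℕ) (p : ℝ) (Ω : Set (Euc n)) (u0 : Euc n → ℝ)
    (u : Euc n → ℝ → ℝ) (T : ℝ≥0∞) : Prop where
  cont : ContinuousOn (fun q : Euc n × ℝ => u q.1 q.2) (closure Ω ×ˢ TimeIcc T)
  grad_cont : ∃ G : Euc n × ℝ → Euc n, ContinuousOn G (closure Ω ×ˢ TimeIcc T) ∧
    ∀ x ∈ Ω, ∀ t ∈ TimeIoo T, G (x, t) = gradient (fun y => u y t) x
  time_reg : ∀ x ∈ Ω, ContDiffOn ℝ 1 (fun s => u x s) (TimeIoo T)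
  space_reg : ∀ t ∈ TimeIoo T, ContDiffOn ℝ 2 (fun y => u y t) Ω
  eqn : ∀ x ∈ Ω, ∀ t ∈ TimeIoo T,
    deriv (fun s => u x s) t = lap n (fun y => u y t) x + ‖gradient (fun y => u y t) x‖ ^ p
  bc : ∀ x ∈ frontier Ω, ∀ t ∈ TimeIcc T, u x t = 0
  ic : ∀ x ∈ closure Ω, u x 0 = u0 x

/-- The Laplacian is additive on `C²` functions. -/
theorem lap_sub {n : ℕ} {f g : Euc n → ℝ} {x : Euc n} (hf : ContDiffAt ℝ 2 f x)
    (hg : ContDiffAt ℝ 2 g x) : lap n (fun y => f y - g y) x = lap n f x - lap n g x := by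
  unfold lap
  rw [← Finset.sum_sub_distrib]
  refine Finset.sum_congr rfl fun i _ => ?_
  have key : ∀ {k : Euc n → ℝ}, ContDiffAt ℝ 2 k x →
      DifferentiableAt ℝ (fun y => fderiv ℝ k y (EuclideanSpace.single i 1)) x := fun {k} hk =>
    ((hk.fderiv_right (m := 1) (by norm_num)).differentiableAt (by norm_num)).clm_apply
      (differentiableAt_const _)
  have hev : (fun y => fderiv ℝ (fun y => f y - g y) y (EuclideanSpace.single i (1 : ℝ))) =ᶠ[𝓝 x]
      fun y => fderiv ℝ f y (EuclideanSpace.single i 1)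
        - fderiv ℝ g y (EuclideanSpace.single i 1) := by
    filter_upwards [hf.eventually (by norm_num), hg.eventually (by norm_num)] with y h1 h2
    rw [fderiv_fun_sub (h1.differentiableAt (by norm_num)) (h2.differentiableAt (by norm_num))]
    rfl
  rw [hev.fderiv_eq, fderiv_fun_sub (key hf) (key hg)]
  rfl

/-- The Laplacian of a sum of `C²` functions. -/
theorem lap_add {n : ℕ} {f g : Euc n → ℝ} {x : Euc n} (hf : ContDiffAt ℝ 2 f x)
    (hg : ContDiffAt ℝ 2 g x) : lap n (fun y => f y + g y) x = lap n f x + lap n g x := by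
  have h := lap_sub (hf.add hg) hg
  have h' : (fun y => f y + g y - g y) = f := by ext y; simp
  rw [h'] at h
  exact (sub_eq_iff_eq_add.1 h.symm)

/-- The gradient of a sum of differentiable functions. -/
theorem gradient_fun_add' {n : ℕ} {f g : Euc n → ℝ} {x : Euc n} (hf : DifferentiableAt ℝ f x)
    (hg : DifferentiableAt ℝ g x) :
    gradient (fun y => f y + g y) x = gradient f x + gradient g x := by
  simp only [gradient]
  rw [fderiv_fun_add hf hg, map_add]

/-- Second derivative test: the second derivative is nonpositive at a local maximum. -/
theorem deriv_deriv_nonpos_of_isLocalMax {f : ℝ → ℝ} {a : ℝ} (h : IsLocalMax f a)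
    (hc : ContinuousAt f a) : deriv (deriv f) a ≤ 0 := by
  by_contra! hpos
  have hmin := isLocalMin_of_deriv_deriv_pos hpos h.deriv_eq_zero hc
  have hconst : f =ᶠ[𝓝 a] fun _ => f a := by
    filter_upwards [h, hmin] with y h1 h2 using le_antisymm h1 h2
  have := hconst.deriv.deriv_eq
  simp at this
  linarith

/-- The Laplacian is nonpositive at a local maximum. -/
theorem lap_nonpos_of_isLocalMax {n : ℕ} {f : Euc n → ℝ} {x : Euc n} (hf : ContDiffAt ℝ 2 f x)
    (h : IsLocalMax f x) : lap n f x ≤ 0 := by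
  refine Finset.sum_nonpos fun i _ => ?_
  set e : Euc n := EuclideanSpace.single i 1
  have hline : ∀ τ : ℝ, HasDerivAt (fun τ : ℝ => x + τ • e) e τ := fun τ => by
    simpa using ((hasDerivAt_id τ).smul_const e).const_add x
  have hx : x + (0 : ℝ) • e = x := by simp
  have hcont : Tendsto (fun τ : ℝ => x + τ • e) (𝓝 0) (𝓝 x) := by
    have := (hline 0).continuousAt.tendsto
    rwa [hx] at this
  have hmax : IsLocalMax (fun τ : ℝ => f (x + τ • e)) 0 := by
    have := hcont.eventually h
    filter_upwards [this] with τ hτ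
    simpa using hτ
  have hd : deriv (fun τ : ℝ => f (x + τ • e)) =ᶠ[𝓝 0] fun τ => fderiv ℝ f (x + τ • e) e := by
    filter_upwards [hcont.eventually (hf.eventually (by norm_num))] with τ hτ
    exact ((hτ.differentiableAt (by norm_num)).hasFDerivAt.comp_hasDerivAt τ (hline τ)).deriv
  have hk : DifferentiableAt ℝ (fun y => fderiv ℝ f y e) x :=
    ((hf.fderiv_right (m := 1) (by norm_num)).differentiableAt (by norm_num)).clm_apply
      (differentiableAt_const _)
  have hk' := hk.hasFDerivAt
  rw [← hx] at hk'
  have hd2 : deriv (deriv (fun τ : ℝ => f (x + τ • e))) 0 = fderiv ℝ (fun y => fderiv ℝ f y e) x e := by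
    rw [hd.deriv_eq]
    have := (hk'.comp_hasDerivAt 0 (hline 0)).deriv
    rw [hx] at this
    exact this
  rw [← hd2]
  refine deriv_deriv_nonpos_of_isLocalMax hmax ?_
  have h1 : ContinuousAt f (x + (0 : ℝ) • e) := by rw [hx]; exact hf.continuousAt
  exact ContinuousAt.comp (f := fun τ : ℝ => x + τ • e) h1 (hline 0).continuousAt

/-- The first and second derivatives of a radial function of `1 - |x|²` in the unit ball. -/
theorem radial_calculus {n : ℕ} {g g1 g2 : ℝ → ℝ} (hg : ∀ s, 0 < s → HasDerivAt g (g1 s) s)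
    (hg1 : ∀ s, 0 < s → HasDerivAt g1 (g2 s) s) {x : Euc n} (hx : ‖x‖ < 1) :
    HasGradientAt (fun y : Euc n => g (1 - ‖y‖ ^ 2)) (-(2 * g1 (1 - ‖x‖ ^ 2)) • x) x ∧
      lap n (fun y => g (1 - ‖y‖ ^ 2)) x
        = 4 * ‖x‖ ^ 2 * g2 (1 - ‖x‖ ^ 2) - 2 * n * g1 (1 - ‖x‖ ^ 2) := by
  have hpos : ∀ y : Euc n, ‖y‖ < 1 → 0 < 1 - ‖y‖ ^ 2 := fun y hy => by
    nlinarith [norm_nonneg y]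
  have hs : ∀ y : Euc n, HasFDerivAt (fun y : Euc n => 1 - ‖y‖ ^ 2) (-(2 • innerSL ℝ y)) y :=
    fun y => (hasStrictFDerivAt_norm_sq y).hasFDerivAt.const_sub 1
  have hcomp : ∀ {k k1 : ℝ → ℝ}, (∀ s, 0 < s → HasDerivAt k (k1 s) s) → ∀ y : Euc n, ‖y‖ < 1 →
      HasFDerivAt (fun y : Euc n => k (1 - ‖y‖ ^ 2))
        (k1 (1 - ‖y‖ ^ 2) • (-(2 • innerSL ℝ y) : Euc n →L[ℝ] ℝ)) y := fun {k k1} hk y hy =>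
    HasDerivAt.comp_hasFDerivAt (h₂ := k) y (hk _ (hpos y hy)) (hs y)
  have hball : ∀ᶠ y : Euc n in 𝓝 x, ‖y‖ < 1 := continuous_norm.continuousAt.eventually_lt_const hx
  refine ⟨?_, ?_⟩
  · rw [hasGradientAt_iff_hasFDerivAt]
    refine (hcomp hg x hx).congr_fderiv ?_
    ext v
    simp
    ring
  · unfold lap
    have hi : ∀ i : Fin n, fderiv ℝ (fun y => fderiv ℝ (fun y : Euc n => g (1 - ‖y‖ ^ 2)) y
        (EuclideanSpace.single i 1)) x (EuclideanSpace.single i 1)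
        = 4 * g2 (1 - ‖x‖ ^ 2) * (x i) ^ 2 - 2 * g1 (1 - ‖x‖ ^ 2) := by
      intro i
      have hev : (fun y => fderiv ℝ (fun y : Euc n => g (1 - ‖y‖ ^ 2)) y
          (EuclideanSpace.single i 1)) =ᶠ[𝓝 x] fun y => g1 (1 - ‖y‖ ^ 2) * (-(2 * y i)) := by
        filter_upwards [hball] with y hy
        rw [(hcomp hg y hy).fderiv]
        simp [EuclideanSpace.inner_single_right]
      have hyi : HasFDerivAt (fun y : Euc n => -(2 * y i))
          (-((2 : ℝ) • (EuclideanSpace.proj i : Euc n →L[ℝ] ℝ))) x :=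
        ((EuclideanSpace.proj i : Euc n →L[ℝ] ℝ).hasFDerivAt.const_mul 2).neg
      rw [hev.fderiv_eq, ((hcomp hg1 x hx).fun_mul hyi).fderiv]
      simp [EuclideanSpace.inner_single_right]
      ring
    rw [Finset.sum_congr rfl fun i _ => hi i, Finset.sum_sub_distrib, ← Finset.mul_sum,
      ← EuclideanSpace.real_norm_sq_eq]
    simp
    ring

/-- Smoothness in the unit ball of a radial function of `1 - |x|²`. -/
theorem radial_contDiffAt {n : ℕ} {g : ℝ → ℝ} (hg : ∀ s, 0 < s → ContDiffAt ℝ 2 g s)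
    {x : Euc n} (hx : ‖x‖ < 1) : ContDiffAt ℝ 2 (fun y : Euc n => g (1 - ‖y‖ ^ 2)) x := by
  have hpos : 0 < 1 - ‖x‖ ^ 2 := by nlinarith [norm_nonneg x]
  exact ContDiffAt.comp x (hg _ hpos) (contDiffAt_const.sub (contDiff_norm_sq ℝ).contDiffAt)

/-- Maximum principle for a function on the closed unit ball and a bounded time interval, in a
form where boundary points are handled by showing that no maximum can be attained there. -/
theorem max_principle {n : ℕ} {T : ℝ} {D : Euc n → ℝ → ℝ}
    (hc : ContinuousOn (fun q : Euc n × ℝ => D q.1 q.2) (closedBall 0 1 ×ˢ Icc 0 T))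
    (h0 : ∀ x ∈ closedBall (0 : Euc n) 1, D x 0 ≤ 0)
    (hb : ∀ x ∈ sphere (0 : Euc n) 1, ∀ t ∈ Ioc 0 T,
      D x t ≤ 0 ∨ ∃ y ∈ closedBall (0 : Euc n) 1, D x t < D y t)
    (hi : ∀ x ∈ ball (0 : Euc n) 1, ∀ t ∈ Ioc 0 T, IsLocalMax (fun y => D y t) x →
      ∃ d ≤ 0, HasDerivAt (fun s => D x s) d t) :
    ∀ x ∈ closedBall (0 : Euc n) 1, ∀ t ∈ Icc 0 T, D x t ≤ 0 := by
  intro x₀ hx₀ t₀ ht₀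
  by_contra! hpos
  have hT : 0 ≤ T := ht₀.1.trans ht₀.2
  obtain ⟨ε, hε, hεpos⟩ : ∃ ε > 0, 0 < D x₀ t₀ - ε * t₀ := by
    refine ⟨D x₀ t₀ / (2 * (T + 1)), by positivity, ?_⟩
    have : D x₀ t₀ / (2 * (T + 1)) * t₀ ≤ D x₀ t₀ / 2 := by
      rw [div_mul_eq_mul_div, div_le_div_iff₀ (by positivity) (by positivity)]
      nlinarith [ht₀.2]
    linarith
  have hcomp : IsCompact (closedBall (0 : Euc n) 1 ×ˢ Icc 0 T) :=
    (isCompact_closedBall 0 1).prod isCompact_Icc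
  obtain ⟨⟨x, t⟩, ⟨hx, ht⟩, hmax⟩ := hcomp.exists_isMaxOn ⟨(x₀, t₀), hx₀, ht₀⟩
    (hc.sub ((continuous_const.mul continuous_snd : Continuous
      fun q : Euc n × ℝ => ε * q.2).continuousOn))
  have hmax' : ∀ y ∈ closedBall (0 : Euc n) 1, ∀ s ∈ Icc 0 T,
      D y s - ε * s ≤ D x t - ε * t := fun y hy s hs => hmax (Set.mk_mem_prod hy hs)
  have hval : 0 < D x t - ε * t := hεpos.trans_le (hmax' _ hx₀ _ ht₀)
  simp only at hx ht
  have ht0 : 0 < t := by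
    rcases ht.1.eq_or_lt with h | h
    · rw [← h] at hval
      have := h0 x hx
      linarith
    · exact h
  have htI : t ∈ Ioc 0 T := ⟨ht0, ht.2⟩
  have hDpos : 0 < D x t := by nlinarith
  have hxb : x ∈ ball (0 : Euc n) 1 := by
    rw [← closedBall_sdiff_sphere]
    refine ⟨hx, fun hsph => ?_⟩
    rcases hb x hsph t htI with h | ⟨y, hy, hlt⟩
    · linarith
    · have := hmax' y hy t ht
      linarith
  obtain ⟨d, hd, hderiv⟩ := hi x hxb t htI (by
    filter_upwards [isOpen_ball.mem_nhds hxb] with y hy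
    have := hmax' y (ball_subset_closedBall hy) t ht
    linarith)
  have hneg : d - ε < 0 := by linarith
  have hder : HasDerivAt (fun s => D x s - ε * s) (d - ε) t := by
    simpa using hderiv.fun_sub ((hasDerivAt_id' t).const_mul ε)
  have hev := hasDerivWithinAt_iff_tendsto_slope.1 (hder.hasDerivWithinAt (s := Iio t))
  have hev2 : ∀ᶠ s in 𝓝[<] t, slope (fun s => D x s - ε * s) t s < 0 := by
    have := hev.eventually_lt_const hneg
    simpa using this
  have hev3 : ∀ᶠ s in 𝓝[<] t, s ∈ Ioo 0 t := Ioo_mem_nhdsLT ht0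
  obtain ⟨s, hs1, hs2⟩ := (hev2.and hev3).exists
  rw [slope_def_field, div_neg_iff] at hs1
  have := hmax' x hx s ⟨hs2.1.le, hs2.2.le.trans ht.2⟩
  rcases hs1 with h | h <;> linarith [hs2.2]

/-- Comparison of a solution of a regularized problem with a classical supersolution. -/
theorem IsRegSol.le_supersolution {n : ℕ} {p : ℝ} {j : ℕ} {u0 : Euc n → ℝ} {u : Euc n → ℝ → ℝ}
    (hu : IsRegSol n p (ball 0 1) j u0 u) {T : ℝ} {v : Euc n → ℝ → ℝ}
    (hvc : ContinuousOn (fun q : Euc n × ℝ => v q.1 q.2) (closedBall 0 1 ×ˢ Icc 0 T))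
    (hv0 : ∀ x ∈ closedBall (0 : Euc n) 1, u0 x ≤ v x 0)
    (hvb : ∀ x ∈ sphere (0 : Euc n) 1, ∀ t ∈ Ioc 0 T, 0 ≤ v x t)
    (hv2 : ∀ x ∈ ball (0 : Euc n) 1, ∀ t ∈ Ioc 0 T, ContDiffAt ℝ 2 (fun y => v y t) x)
    (hvt : ∀ x ∈ ball (0 : Euc n) 1, ∀ t ∈ Ioc 0 T, ∃ d, HasDerivAt (fun s => v x s) d t ∧
      lap n (fun y => v y t) x + ‖gradient (fun y => v y t) x‖ ^ p ≤ d) :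
    ∀ x ∈ closedBall (0 : Euc n) 1, ∀ t ∈ Icc 0 T, u x t ≤ v x t := by
  have hcl : closure (ball (0 : Euc n) 1) = closedBall 0 1 := closure_ball 0 one_ne_zero
  have hfr : frontier (ball (0 : Euc n) 1) = sphere 0 1 := frontier_ball 0 one_ne_zero
  have hmp := max_principle (T := T) (D := fun x t => u x t - v x t) ?_ ?_ ?_ ?_
  · intro x hx t ht
    linarith [hmp x hx t ht]
  · refine ContinuousOn.sub ?_ hvc
    have := hu.cont
    rw [hcl] at this
    exact this.mono (prod_mono_right Icc_subset_Ici_self)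
  · intro x hx
    have h1 := hu.ic x (hcl ▸ hx)
    have h2 := hv0 x hx
    simp only [h1]
    linarith
  · intro x hx t ht
    have h1 := hu.bc x (hfr ▸ hx) t ht.1
    have h2 := hvb x hx t ht
    left
    simp only [h1]
    linarith
  · intro x hx t ht hmax
    have hu2 : ContDiffAt ℝ 2 (fun y => u y t) x :=
      (hu.space_reg t ht.1).contDiffAt (isOpen_ball.mem_nhds hx)
    have hut : HasDerivAt (fun s => u x s) (deriv (fun s => u x s) t) t :=
      (((hu.time_reg x hx).contDiffAt (Ioi_mem_nhds ht.1)).differentiableAt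
        (by norm_num)).hasDerivAt
    obtain ⟨d, hd, hle⟩ := hvt x hx t ht
    refine ⟨_, ?_, hut.fun_sub hd⟩
    have hlap := lap_nonpos_of_isLocalMax (hu2.sub (hv2 x hx t ht)) hmax
    have hlap' := lap_sub hu2 (hv2 x hx t ht)
    have hlap2 : lap n (fun y => u y t) x - lap n (fun y => v y t) x ≤ 0 := hlap' ▸ hlap
    have hgrad : gradient (fun y => u y t) x = gradient (fun y => v y t) x := by
      have := hmax.fderiv_eq_zero
      rw [fderiv_fun_sub (hu2.differentiableAt (by norm_num))
        ((hv2 x hx t ht).differentiableAt (by norm_num)), sub_eq_zero] at this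
      simp only [gradient, this]
    rw [hu.eqn x hx t ht.1, hgrad]
    have hF : Fj n p j (gradient (fun y => v y t) x) ≤ ‖gradient (fun y => v y t) x‖ ^ p :=
      min_le_left _ _
    linarith

theorem mem_timeIcc_top {t : ℝ} : t ∈ TimeIcc ⊤ ↔ 0 ≤ t := by
  simp [TimeIcc]

theorem mem_timeIoo_top {t : ℝ} : t ∈ TimeIoo ⊤ ↔ 0 < t := by
  simp [TimeIoo]

section Classical

variable {n : ℕ} {p : ℝ} {u0 : Euc n → ℝ} {u : Euc n → ℝ → ℝ}

theorem IsClassicalSol.continuousOn_closedBall (hu : IsClassicalSol n p (ball 0 1) u0 u ⊤) (T : ℝ) :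
    ContinuousOn (fun q : Euc n × ℝ => u q.1 q.2) (closedBall 0 1 ×ˢ Icc 0 T) := by
  have := hu.cont
  rw [closure_ball 0 one_ne_zero] at this
  exact this.mono (prod_mono_right fun t ht => mem_timeIcc_top.2 ht.1)

theorem IsClassicalSol.contDiffAt (hu : IsClassicalSol n p (ball 0 1) u0 u ⊤) {x : Euc n}
    (hx : x ∈ ball 0 1) {t : ℝ} (ht : 0 < t) : ContDiffAt ℝ 2 (fun y => u y t) x :=
  (hu.space_reg t (mem_timeIoo_top.2 ht)).contDiffAt (isOpen_ball.mem_nhds hx)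

theorem IsClassicalSol.hasDerivAt (hu : IsClassicalSol n p (ball 0 1) u0 u ⊤) {x : Euc n}
    (hx : x ∈ ball 0 1) {t : ℝ} (ht : 0 < t) :
    HasDerivAt (fun s => u x s)
      (lap n (fun y => u y t) x + ‖gradient (fun y => u y t) x‖ ^ p) t := by
  rw [← hu.eqn x hx t (mem_timeIoo_top.2 ht)]
  have hmem : TimeIoo ⊤ ∈ 𝓝 t := by
    filter_upwards [Ioi_mem_nhds ht] with s hs using mem_timeIoo_top.2 hs
  exact (((hu.time_reg x hx).contDiffAt hmem).differentiableAt (by norm_num)).hasDerivAt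

theorem IsClassicalSol.eq_zero_of_mem_sphere (hu : IsClassicalSol n p (ball 0 1) u0 u ⊤) {x : Euc n}
    (hx : x ∈ sphere 0 1) {t : ℝ} (ht : 0 ≤ t) : u x t = 0 :=
  hu.bc x (by rwa [frontier_ball 0 one_ne_zero]) t (mem_timeIcc_top.2 ht)

theorem IsClassicalSol.exists_gradient_bound (hu : IsClassicalSol n p (ball 0 1) u0 u ⊤) (T : ℝ) :
    ∃ K > 0, ∀ x ∈ ball (0 : Euc n) 1, ∀ t ∈ Ioc 0 T, ‖gradient (fun y => u y t) x‖ ≤ K := by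
  obtain ⟨G, hG, hGu⟩ := hu.grad_cont
  rw [closure_ball 0 one_ne_zero] at hG
  obtain ⟨C, hC⟩ := ((isCompact_closedBall (0 : Euc n) 1).prod
    (isCompact_Icc (a := (0 : ℝ)) (b := T))).exists_bound_of_continuousOn
    (hG.mono (prod_mono_right fun t ht => mem_timeIcc_top.2 ht.1))
  refine ⟨max C 1, by positivity, fun x hx t ht => ?_⟩
  rw [← hGu x hx t (mem_timeIoo_top.2 ht.1)]
  exact (hC (x, t) ⟨ball_subset_closedBall hx, ht.1.le, ht.2⟩).trans (le_max_left _ _)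

/-- A classical solution is bounded by a multiple of the distance to any boundary point. -/
theorem IsClassicalSol.le_mul_norm_sub (hu : IsClassicalSol n p (ball 0 1) u0 u ⊤) {K t : ℝ}
    (ht : 0 < t) (hK : ∀ x ∈ ball (0 : Euc n) 1, ‖gradient (fun y => u y t) x‖ ≤ K) {x y : Euc n}
    (hx : x ∈ sphere 0 1) (hy : y ∈ closedBall (0 : Euc n) 1) : u y t ≤ K * ‖y - x‖ := by
  have hcont : ContinuousOn (fun y => u y t) (closedBall 0 1) := by
    have := hu.continuousOn_closedBall t
    exact this.comp (f := fun y : Euc n => (y, t)) (by fun_prop) fun y hy => ⟨hy, ht.le, le_rfl⟩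
  have hin : ∀ y ∈ ball (0 : Euc n) 1, ∀ z ∈ ball (0 : Euc n) 1, |u y t - u z t| ≤ K * ‖y - z‖ := by
    intro y hy z hz
    refine (convex_ball (0 : Euc n) 1).norm_image_sub_le_of_norm_fderiv_le (𝕜 := ℝ)
      (f := fun y => u y t) (fun w hw => (hu.contDiffAt hw ht).differentiableAt (by norm_num))
      (fun w hw => ?_) hz hy
    rw [← toDual_gradient, LinearIsometryEquiv.norm_map]
    exact hK w hw
  have hlim : Tendsto (fun r : ℝ => u (r • y) t - u (r • x) t) (𝓝[<] 1) (𝓝 (u y t - u x t)) := by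
    have key : ∀ z ∈ closedBall (0 : Euc n) 1, Tendsto (fun r : ℝ => u (r • z) t) (𝓝[<] 1)
        (𝓝 (u z t)) := by
      intro z hz
      refine (hcont z hz).tendsto.comp (tendsto_nhdsWithin_iff.2 ⟨?_, ?_⟩)
      · have : Tendsto (fun r : ℝ => r • z) (𝓝 1) (𝓝 ((1 : ℝ) • z)) :=
          (continuous_id.smul continuous_const).tendsto 1
        rw [one_smul] at this
        exact this.mono_left nhdsWithin_le_nhds
      · filter_upwards [Ioo_mem_nhdsLT (zero_lt_one' ℝ)] with r hr
        rw [mem_closedBall_zero_iff] at hz ⊢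
        rw [norm_smul, Real.norm_of_nonneg hr.1.le]
        nlinarith [hr.1, hr.2, norm_nonneg z]
    exact (key y hy).sub (key x (sphere_subset_closedBall hx))
  rw [hu.eq_zero_of_mem_sphere hx ht.le, sub_zero] at hlim
  refine le_of_tendsto hlim ?_
  filter_upwards [Ioo_mem_nhdsLT (zero_lt_one' ℝ)] with r hr
  have hmem : ∀ z ∈ closedBall (0 : Euc n) 1, r • z ∈ ball (0 : Euc n) 1 := by
    intro z hz
    rw [mem_closedBall_zero_iff] at hz
    rw [mem_ball_zero_iff, norm_smul, Real.norm_of_nonneg hr.1.le]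
    nlinarith [hr.1, hr.2, norm_nonneg z]
  refine (le_abs_self _).trans ((hin _ (hmem y hy) _ (hmem x (sphere_subset_closedBall hx))).trans ?_)
  have hK0 : 0 ≤ K := (norm_nonneg _).trans (hK 0 (by simp))
  rw [← smul_sub, norm_smul, Real.norm_of_nonneg hr.1.le]
  have := mul_nonneg hK0 (norm_nonneg (y - x))
  nlinarith [hr.2]

/-- A subsolution whose inward slope is infinite at the boundary stays below any classical solution
lying above it initially, whatever its boundary values. -/
theorem IsClassicalSol.subsolution_le (hu : IsClassicalSol n p (ball 0 1) u0 u ⊤) {T : ℝ}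
    {w : Euc n → ℝ → ℝ}
    (hwc : ContinuousOn (fun q : Euc n × ℝ => w q.1 q.2) (closedBall 0 1 ×ˢ Icc 0 T))
    (hw0 : ∀ x ∈ closedBall (0 : Euc n) 1, w x 0 ≤ u0 x)
    (hwb : ∀ x ∈ sphere (0 : Euc n) 1, ∀ t ∈ Ioc 0 T, ∀ K > 0,
      ∃ y ∈ closedBall (0 : Euc n) 1, w x t + K * ‖y - x‖ < w y t)
    (hw2 : ∀ x ∈ ball (0 : Euc n) 1, ∀ t ∈ Ioc 0 T, ContDiffAt ℝ 2 (fun y => w y t) x)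
    (hwt : ∀ x ∈ ball (0 : Euc n) 1, ∀ t ∈ Ioc 0 T, ∃ d, HasDerivAt (fun s => w x s) d t ∧
      d ≤ lap n (fun y => w y t) x + ‖gradient (fun y => w y t) x‖ ^ p) :
    ∀ x ∈ closedBall (0 : Euc n) 1, ∀ t ∈ Icc 0 T, w x t ≤ u x t := by
  obtain ⟨K, hKpos, hK⟩ := hu.exists_gradient_bound T
  have hmp := max_principle (T := T) (D := fun x t => w x t - u x t) ?_ ?_ ?_ ?_
  · intro x hx t ht
    linarith [hmp x hx t ht]
  · exact hwc.sub (hu.continuousOn_closedBall T)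
  · intro x hx
    have h1 := hu.ic x (by rwa [closure_ball 0 one_ne_zero])
    have h2 := hw0 x hx
    simp only [h1]
    linarith
  · intro x hx t ht
    obtain ⟨y, hy, hlt⟩ := hwb x hx t ht K hKpos
    refine Or.inr ⟨y, hy, ?_⟩
    have h1 := hu.eq_zero_of_mem_sphere hx ht.1.le
    have h2 := hu.le_mul_norm_sub ht.1 (fun z hz => hK z hz t ht) hx hy
    simp only [h1]
    linarith
  · intro x hx t ht hmax
    have hu2 := hu.contDiffAt hx ht.1
    obtain ⟨d, hd, hle⟩ := hwt x hx t ht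
    refine ⟨_, ?_, hd.fun_sub (hu.hasDerivAt hx ht.1)⟩
    have hlap := lap_nonpos_of_isLocalMax ((hw2 x hx t ht).sub hu2) hmax
    have hlap' := lap_sub (hw2 x hx t ht) hu2
    have hlap2 : lap n (fun y => w y t) x - lap n (fun y => u y t) x ≤ 0 := hlap' ▸ hlap
    have hgrad : gradient (fun y => w y t) x = gradient (fun y => u y t) x := by
      have := hmax.fderiv_eq_zero
      rw [fderiv_fun_sub ((hw2 x hx t ht).differentiableAt (by norm_num))
        (hu2.differentiableAt (by norm_num)), sub_eq_zero] at this
      simp only [gradient, this]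
    rw [hgrad] at hle
    linarith

end Classical

/-- The profile `s ↦ s ^ α`, `α = (p - 2) / (p - 1)`, with a large amplitude `a` yields a
subsolution once it is allowed to decrease fast in time away from the boundary. -/
theorem singular_profile_subsolution {p α A a N L r : ℝ} (hp : 2 < p) (hα0 : 0 < α) (hα1 : α < 1)
    (hαp : (α - 1) * p = α - 2) (hN : 0 ≤ N) (hA : α * A = 2 * (5 + 2 * N))
    (hL : L = 2 * (1 + A * (2 + 4 * N))) (ha : A / 2 ≤ a) (haA : a ≤ A) (hr0 : 0 ≤ r)
    (hr1 : r < 1) :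
    1 - L * (1 - r ^ 2) ^ α ≤ 4 * r ^ 2 * (a * α * (α - 1) * (1 - r ^ 2) ^ (α - 2))
      - 2 * N * (a * α * (1 - r ^ 2) ^ (α - 1)) + (2 * (a * α * (1 - r ^ 2) ^ (α - 1)) * r) ^ p := by
  have hs0 : 0 < 1 - r ^ 2 := by nlinarith
  have hs1 : 1 - r ^ 2 ≤ 1 := by nlinarith [sq_nonneg r]
  set s := 1 - r ^ 2 with hs
  have hApos : 0 < A := by
    by_contra! h
    nlinarith
  have hapos : 0 < a := by linarith
  have hb : 5 + 2 * N ≤ a * α := by nlinarith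
  have hbA : a * α ≤ A := by nlinarith
  set b := a * α with hbdef
  have hbpos : 0 < b := by linarith
  have hσ : 0 < s ^ (α - 2) := Real.rpow_pos_of_pos hs0 _
  have hσ1 : 1 ≤ s ^ (α - 2) := Real.one_le_rpow_of_pos_of_le_one_of_nonpos hs0 hs1 (by linarith)
  have hτ : s ^ (α - 1) ≤ s ^ (α - 2) := Real.rpow_le_rpow_of_exponent_ge hs0 hs1 (by linarith)
  have hτ0 : 0 < s ^ (α - 1) := Real.rpow_pos_of_pos hs0 _
  have hsα0 : 0 < s ^ α := Real.rpow_pos_of_pos hs0 _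
  have hLpos : 0 < L := by rw [hL]; positivity
  have hlap : -(b * (4 + 2 * N) * s ^ (α - 2)) ≤
      4 * r ^ 2 * (b * (α - 1) * s ^ (α - 2)) - 2 * N * (b * s ^ (α - 1)) := by
    have h1 : r ^ 2 * (1 - α) * (b * s ^ (α - 2)) ≤ 1 * (b * s ^ (α - 2)) := by
      refine mul_le_mul_of_nonneg_right ?_ (by positivity)
      nlinarith
    have h2 : N * b * s ^ (α - 1) ≤ N * b * s ^ (α - 2) :=
      mul_le_mul_of_nonneg_left hτ (by positivity)
    nlinarith
  rcases le_total r (1 / 2) with hr | hr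
  · have hs34 : 3 / 4 ≤ s := by nlinarith
    have hσ2 : s ^ (α - 2) ≤ 2 := by
      have h1 : s ^ (α - 2) ≤ s ^ (-2 : ℝ) :=
        Real.rpow_le_rpow_of_exponent_ge hs0 hs1 (by linarith)
      have h2 : s ^ (-2 : ℝ) = (s ^ 2)⁻¹ := by
        rw [Real.rpow_neg hs0.le]
        norm_num
      rw [h2] at h1
      have h3 : (s ^ 2)⁻¹ ≤ 2 := by
        rw [inv_le_comm₀ (by positivity) (by norm_num)]
        nlinarith
      linarith
    have hsα : s ≤ s ^ α := by
      simpa using Real.rpow_le_rpow_of_exponent_ge hs0 hs1 hα1.le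
    have hpow : 0 ≤ (2 * (b * s ^ (α - 1)) * r) ^ p := by positivity
    have h1 : r ^ 2 * (1 - α) ≤ 1 / 4 := by nlinarith [sq_nonneg r]
    have h2 : r ^ 2 * (1 - α) * (b * s ^ (α - 2)) ≤ 1 / 4 * (b * s ^ (α - 2)) :=
      mul_le_mul_of_nonneg_right h1 (by positivity)
    have h3 : N * b * s ^ (α - 1) ≤ N * b * 2 :=
      mul_le_mul_of_nonneg_left (hτ.trans hσ2) (by positivity)
    have h4 : b * s ^ (α - 2) ≤ b * 2 := mul_le_mul_of_nonneg_left hσ2 hbpos.le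
    have h5 : b * (2 + 4 * N) ≤ A * (2 + 4 * N) := mul_le_mul_of_nonneg_right hbA (by positivity)
    have h6 : L * (3 / 4) ≤ L * s ^ α := mul_le_mul_of_nonneg_left (hs34.trans hsα) hLpos.le
    have h7 : 0 < A * (2 + 4 * N) := by positivity
    linarith
  · have hpow : b ^ 2 * s ^ (α - 2) ≤ (2 * (b * s ^ (α - 1)) * r) ^ p := by
      have h1 : b * s ^ (α - 1) ≤ 2 * (b * s ^ (α - 1)) * r := by
        have : 0 < b * s ^ (α - 1) := by positivity
        nlinarith
      have h2 : (b * s ^ (α - 1)) ^ p ≤ (2 * (b * s ^ (α - 1)) * r) ^ p :=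
        Real.rpow_le_rpow (by positivity) h1 (by linarith)
      rw [Real.mul_rpow hbpos.le hτ0.le, ← Real.rpow_mul hs0.le, hαp] at h2
      have h3 : b ^ 2 ≤ b ^ p := by
        rw [← Real.rpow_natCast]
        exact Real.rpow_le_rpow_of_exponent_le (by linarith) (by norm_num; linarith)
      exact (mul_le_mul_of_nonneg_right h3 hσ.le).trans h2
    have hquad : b * (4 + 2 * N) + 1 ≤ b ^ 2 := by nlinarith
    have := mul_le_mul_of_nonneg_right hquad hσ.le
    have := mul_pos hLpos hsα0
    linarith

/-- Large multiples of `1 - |x|²` admit no global classical solution. -/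
theorem exists_forall_not_isClassicalSol (n : ℕ) (hn : 1 ≤ n) {p : ℝ} (hp : 2 < p) :
    ∃ Λ : ℝ, ∀ l, Λ ≤ l → ∀ u : Euc n → ℝ → ℝ,
      ¬ IsClassicalSol n p (ball 0 1) (fun x => l * (1 - ‖x‖ ^ 2)) u ⊤ := by
  set α : ℝ := (p - 2) / (p - 1) with hα
  have hp1 : 0 < p - 1 := by linarith
  have hα0 : 0 < α := div_pos (by linarith) hp1
  have hα1 : α < 1 := by rw [hα, div_lt_one hp1]; linarith
  have hαp : (α - 1) * p = α - 2 := by rw [hα]; field_simp; ring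
  set A : ℝ := 2 * (5 + 2 * n) / α with hAdef
  have hA : α * A = 2 * (5 + 2 * (n : ℝ)) := by rw [hAdef]; field_simp
  have hApos : 0 < A := by positivity
  set L : ℝ := 2 * (1 + A * (2 + 4 * n)) with hL
  have hLpos : 0 < L := by positivity
  set T : ℝ := A / (2 * L) with hT
  have hTpos : 0 < T := by positivity
  have hLT : L * T = A / 2 := by rw [hT]; field_simp
  obtain ⟨s₀, hs₀, hs₀'⟩ : ∃ s₀ > 0, A * s₀ ^ α ≤ T / 2 := by
    refine ⟨(T / (2 * A)) ^ α⁻¹, by positivity, ?_⟩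
    rw [Real.rpow_inv_rpow (by positivity) hα0.ne']
    refine le_of_eq ?_
    field_simp
  refine ⟨A / s₀, fun l hl u hu => ?_⟩
  have hls₀ : A ≤ l * s₀ := (div_le_iff₀ hs₀).1 hl
  have hlpos : 0 < l := lt_of_lt_of_le (by positivity) hl
  have hpos : ∀ x ∈ ball (0 : Euc n) 1, 0 < 1 - ‖x‖ ^ 2 := fun x hx => by
    rw [mem_ball_zero_iff] at hx
    nlinarith [norm_nonneg x]
  have hnonneg : ∀ x ∈ closedBall (0 : Euc n) 1, 0 ≤ 1 - ‖x‖ ^ 2 := fun x hx => by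
    rw [mem_closedBall_zero_iff] at hx
    nlinarith [norm_nonneg x]
  have hle := hu.subsolution_le (T := T)
    (w := fun x t => (t - T / 2) + (A - L * t) * (1 - ‖x‖ ^ 2) ^ α) ?_ ?_ ?_ ?_ ?_
  · set e : Euc n := EuclideanSpace.single ⟨0, hn⟩ 1
    have he : ‖e‖ = 1 := by simp [e]
    have h1 := hle e (by simp [he]) T ⟨hTpos.le, le_rfl⟩
    rw [hu.eq_zero_of_mem_sphere (by simp [he]) hTpos.le, he] at h1
    simp only [one_pow, sub_self, Real.zero_rpow hα0.ne', mul_zero] at h1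
    linarith
  · refine Continuous.continuousOn ?_
    have : Continuous fun q : Euc n × ℝ => (1 - ‖q.1‖ ^ 2) ^ α :=
      Continuous.rpow_const (by fun_prop) fun _ => Or.inr hα0.le
    fun_prop
  · intro x hx
    have hs := hnonneg x hx
    have hs1 : 1 - ‖x‖ ^ 2 ≤ 1 := by nlinarith [sq_nonneg ‖x‖]
    simp only [mul_zero, sub_zero, zero_sub]
    generalize 1 - ‖x‖ ^ 2 = s at hs hs1 ⊢
    rcases le_total s s₀ with h | h
    · have h1 : A * s ^ α ≤ A * s₀ ^ α :=
        mul_le_mul_of_nonneg_left (Real.rpow_le_rpow hs h hα0.le) hApos.le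
      nlinarith
    · have h1 : A * s ^ α ≤ A * 1 :=
        mul_le_mul_of_nonneg_left (Real.rpow_le_one hs hs1 hα0.le) hApos.le
      nlinarith
  · intro x hx t ht K hK
    rw [mem_sphere_zero_iff_norm] at hx
    have ha : 0 < A - L * t := by nlinarith [ht.2]
    have hlim : Tendsto (fun h : ℝ => K * h ^ (1 - α)) (𝓝[>] 0) (𝓝 0) := by
      have : Continuous fun h : ℝ => K * h ^ (1 - α) :=
        continuous_const.mul (Real.continuous_rpow_const (by linarith))
      have h2 := this.tendsto 0
      rw [Real.zero_rpow (by linarith), mul_zero] at h2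
      exact h2.mono_left nhdsWithin_le_nhds
    obtain ⟨h, hh1, hh2⟩ := ((hlim.eventually_lt_const ha).and
      (Ioo_mem_nhdsGT (zero_lt_one' ℝ))).exists
    refine ⟨(1 - h) • x, ?_, ?_⟩
    · rw [mem_closedBall_zero_iff, norm_smul, hx, Real.norm_of_nonneg (by linarith [hh2.2])]
      linarith [hh2.1]
    · have hdist : ‖(1 - h) • x - x‖ = h := by
        have : (1 - h) • x - x = (-h) • x := by module
        rw [this, norm_smul, hx, norm_neg, Real.norm_of_nonneg hh2.1.le, mul_one]
      have hnorm : ‖(1 - h) • x‖ = 1 - h := by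
        rw [norm_smul, hx, Real.norm_of_nonneg (by linarith [hh2.2]), mul_one]
      simp only [hdist, hnorm, hx]
      have h1 : h ^ α ≤ (1 - (1 - h) ^ 2) ^ α :=
        Real.rpow_le_rpow hh2.1.le (by nlinarith [hh2.1, hh2.2]) hα0.le
      have h2 : K * h < (A - L * t) * h ^ α := by
        have h3 : h = h ^ (1 - α) * h ^ α := by
          rw [← Real.rpow_add hh2.1]
          simp
        have h4 : 0 < h ^ α := Real.rpow_pos_of_pos hh2.1 _
        calc K * h = K * h ^ (1 - α) * h ^ α := by rw [mul_assoc, ← h3]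
          _ < (A - L * t) * h ^ α := mul_lt_mul_of_pos_right hh1 h4
      have h5 := mul_le_mul_of_nonneg_left h1 ha.le
      simp only [one_pow, sub_self, Real.zero_rpow hα0.ne', mul_zero]
      linarith
  · intro x hx t _
    exact radial_contDiffAt (g := fun s => (t - T / 2) + (A - L * t) * s ^ α)
      (fun s hs => contDiffAt_const.add (contDiffAt_const.mul
        (Real.contDiffAt_rpow_const_of_ne hs.ne'))) (mem_ball_zero_iff.1 hx)
  · intro x hx t ht
    have hx1 : ‖x‖ < 1 := mem_ball_zero_iff.1 hx
    have ha : A / 2 ≤ A - L * t := by nlinarith [ht.2]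
    have haA : A - L * t ≤ A := by nlinarith [ht.1]
    refine ⟨1 - L * (1 - ‖x‖ ^ 2) ^ α, ?_, ?_⟩
    · have h1 : HasDerivAt (fun s : ℝ => s - T / 2) 1 t := (hasDerivAt_id' t).sub_const _
      have h2 : HasDerivAt (fun s : ℝ => A - L * s) (-L) t := by
        simpa using ((hasDerivAt_id' t).const_mul L).const_sub A
      exact (h1.fun_add (h2.mul_const ((1 - ‖x‖ ^ 2) ^ α))).congr_deriv (by ring)
    · obtain ⟨hgrad, hlap⟩ := radial_calculus
        (g := fun s => (t - T / 2) + (A - L * t) * s ^ α)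
        (g1 := fun s => (A - L * t) * α * s ^ (α - 1))
        (g2 := fun s => (A - L * t) * α * (α - 1) * s ^ (α - 2))
        (fun s hs => (((Real.hasDerivAt_rpow_const (p := α) (Or.inl hs.ne')).const_mul
          (A - L * t)).const_add (t - T / 2)).congr_deriv (by ring))
        (fun s hs => ((Real.hasDerivAt_rpow_const (p := α - 1) (Or.inl hs.ne')).const_mul
          ((A - L * t) * α)).congr_deriv (by rw [show α - 1 - 1 = α - 2 by ring]; ring)) hx1
      rw [hgrad.gradient, hlap, norm_smul, norm_neg, Real.norm_of_nonneg]
      · exact singular_profile_subsolution hp hα0 hα1 hαp n.cast_nonneg hA hL ha haA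
          (norm_nonneg x) hx1
      · have := (Real.rpow_pos_of_pos (hpos x hx) (α - 1))
        have : 0 < A - L * t := by linarith
        positivity

theorem add_rpow_le_of_add_le {p x y M : ℝ} (hp : 1 ≤ p) (hx : 0 ≤ x) (hy : 0 ≤ y)
    (hM : x + y ≤ M) : (x + y) ^ p ≤ x ^ p + p * M ^ (p - 1) * y := by
  rcases (add_nonneg hx hy).eq_or_lt with h | h
  · have hx0 : x = 0 := by linarith
    have hy0 : y = 0 := by linarith
    simp [hx0, hy0]
  · set z := x + y with hz
    have hB := one_add_mul_self_le_rpow_one_add (s := x / z - 1)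
      (by linarith [div_nonneg hx h.le]) hp
    rw [add_sub_cancel, Real.div_rpow hx h.le] at hB
    have hzp : 0 < z ^ p := Real.rpow_pos_of_pos h p
    have hzp' : z ^ p = z ^ (p - 1) * z := by
      rw [← Real.rpow_add_one h.ne']
      ring_nf
    rw [le_div_iff₀ hzp] at hB
    have h1 : (1 + p * (x / z - 1)) * z ^ p = z ^ p - p * z ^ (p - 1) * y := by
      rw [hzp']
      field_simp
      rw [hz]
      ring
    have h2 : z ^ (p - 1) ≤ M ^ (p - 1) := Real.rpow_le_rpow h.le hM (by linarith)
    have h3 : p * z ^ (p - 1) * y ≤ p * M ^ (p - 1) * y :=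
      mul_le_mul_of_nonneg_right (mul_le_mul_of_nonneg_left h2 (by linarith)) hy
    linarith

/-- On a bounded time interval, a suitable function positive in the ball and vanishing on the
boundary can be added to a classical solution so as to produce a supersolution. -/
theorem IsClassicalSol.exists_supersolution_add {n : ℕ} (hn : 1 ≤ n) {p : ℝ} (hp : 2 < p)
    {u0 : Euc n → ℝ} {u : Euc n → ℝ → ℝ} (hu : IsClassicalSol n p (ball 0 1) u0 u ⊤) (T : ℝ) :
    ∃ h : Euc n → ℝ, ContDiff ℝ 2 h ∧ (∀ x ∈ sphere (0 : Euc n) 1, h x = 0) ∧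
      (∃ ε > 0, ∀ x ∈ closedBall (0 : Euc n) 1, ε * (1 - ‖x‖ ^ 2) ≤ h x) ∧
      ∀ x ∈ ball (0 : Euc n) 1, ∀ t ∈ Ioc 0 T,
        lap n (fun y => u y t + h y) x + ‖gradient (fun y => u y t + h y) x‖ ^ p ≤
          lap n (fun y => u y t) x + ‖gradient (fun y => u y t) x‖ ^ p := by
  obtain ⟨K, hKpos, hK⟩ := hu.exists_gradient_bound T
  set C : ℝ := p * (K + 1) ^ (p - 1) with hC
  set a : ℝ := C ^ 2 + 1 with ha
  have hapos : 0 < a := by positivity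
  set δ : ℝ := 1 / (2 * a) with hδ
  have hδpos : 0 < δ := by positivity
  have hδa : δ * a = 1 / 2 := by rw [hδ]; field_simp
  have hsmooth : ContDiff ℝ 2 fun x : Euc n => δ * (1 - Real.exp (-a * (1 - ‖x‖ ^ 2))) := by
    have : ContDiff ℝ 2 fun x : Euc n => ‖x‖ ^ 2 := contDiff_norm_sq ℝ
    fun_prop
  refine ⟨fun x => δ * (1 - Real.exp (-a * (1 - ‖x‖ ^ 2))), hsmooth, ?_,
    ⟨δ * (a / (1 + a)), by positivity, ?_⟩, ?_⟩
  · intro x hx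
    rw [mem_sphere_zero_iff_norm] at hx
    simp [hx]
  · intro x hx
    rw [mem_closedBall_zero_iff] at hx
    have hs0 : 0 ≤ 1 - ‖x‖ ^ 2 := by nlinarith [norm_nonneg x]
    have hs1 : 1 - ‖x‖ ^ 2 ≤ 1 := by nlinarith [sq_nonneg ‖x‖]
    simp only
    generalize 1 - ‖x‖ ^ 2 = s at hs0 hs1 ⊢
    rw [mul_assoc]
    refine mul_le_mul_of_nonneg_left ?_ hδpos.le
    have h1 : Real.exp (-a * s) ≤ (1 + a * s)⁻¹ := by
      rw [neg_mul, Real.exp_neg]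
      refine inv_anti₀ (by positivity) ?_
      linarith [Real.add_one_le_exp (a * s)]
    have h2 : a / (1 + a) * s ≤ 1 - (1 + a * s)⁻¹ := by
      have : 1 - (1 + a * s)⁻¹ = a * s / (1 + a * s) := by
        field_simp
        ring
      rw [this, div_mul_eq_mul_div]
      refine div_le_div_of_nonneg_left (by positivity) (by positivity) ?_
      nlinarith
    linarith
  · intro x hx t ht
    have hx1 : ‖x‖ < 1 := mem_ball_zero_iff.1 hx
    have hexp : ∀ s : ℝ, HasDerivAt (fun s => Real.exp (-a * s)) (Real.exp (-a * s) * -a) s :=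
      fun s => by simpa using ((hasDerivAt_id' s).const_mul (-a)).exp
    obtain ⟨hgrad, hlap⟩ := radial_calculus (n := n) (x := x)
      (g := fun s => δ * (1 - Real.exp (-a * s)))
      (g1 := fun s => δ * (a * Real.exp (-a * s)))
      (g2 := fun s => δ * (-a ^ 2 * Real.exp (-a * s)))
      (fun s _ => (((hexp s).const_sub 1).const_mul δ).congr_deriv (by ring))
      (fun s _ => (((hexp s).const_mul a).const_mul δ).congr_deriv (by ring)) hx1
    have hu2 := hu.contDiffAt hx ht.1
    rw [lap_add hu2 hsmooth.contDiffAt, hlap,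
      gradient_fun_add' (hu2.differentiableAt (by norm_num)) hgrad.differentiableAt, hgrad.gradient]
    set E := Real.exp (-a * (1 - ‖x‖ ^ 2)) with hE
    have hE0 : 0 < E := Real.exp_pos _
    have hE1 : E ≤ 1 := Real.exp_le_one_iff.2 (by nlinarith [norm_nonneg x])
    have hnorm : ‖-(2 * (δ * (a * E))) • x‖ = E * ‖x‖ := by
      rw [norm_smul, norm_neg, Real.norm_of_nonneg (by positivity), ← mul_assoc δ, hδa]
      ring
    have hy : E * ‖x‖ ≤ 1 := by nlinarith [norm_nonneg x]
    have h1 : ‖gradient (fun y => u y t) x + -(2 * (δ * (a * E))) • x‖ ^ p ≤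
        ‖gradient (fun y => u y t) x‖ ^ p + C * (E * ‖x‖) := by
      refine (Real.rpow_le_rpow (norm_nonneg _) (norm_add_le _ _) (by linarith)).trans ?_
      rw [hnorm]
      exact add_rpow_le_of_add_le (by linarith) (norm_nonneg _) (by positivity)
        (add_le_add (hK x hx t ht) hy)
    have hn' : (1 : ℝ) ≤ n := by exact_mod_cast hn
    have h2 : 4 * ‖x‖ ^ 2 * (δ * (-a ^ 2 * E)) - 2 * n * (δ * (a * E))
        = -(E * (2 * a * ‖x‖ ^ 2 + n)) := by
      linear_combination (-(4 * ‖x‖ ^ 2 * a * E) - 2 * n * E) * hδa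
    have h3 : C * ‖x‖ ≤ 2 * a * ‖x‖ ^ 2 + n := by
      rw [ha]
      nlinarith [sq_nonneg (C * ‖x‖ - 1), sq_nonneg ‖x‖]
    have h4 := mul_le_mul_of_nonneg_left h3 hE0.le
    rw [h2]
    linarith

/-- After a time controlled by the initial maximum, the solutions of the regularized problems lie
below a fixed barrier vanishing on the boundary. -/
theorem IsRegSol.le_barrier {n : ℕ} (hn : 1 ≤ n) {p : ℝ} (hp : 2 < p) {j : ℕ} {u0 : Euc n → ℝ}
    {u : Euc n → ℝ → ℝ} (hu : IsRegSol n p (ball 0 1) j u0 u) {M t₀ : ℝ} (hM : 0 ≤ M)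
    (hu0 : ∀ x ∈ closedBall (0 : Euc n) 1, u0 x ≤ M) (ht₀ : 0 < t₀) (hMt : 4 * M ≤ t₀) :
    ∀ x ∈ closedBall (0 : Euc n) 1, u x t₀ ≤ 1 / 4 * (1 - ‖x‖ ^ 2) := by
  have hη : M / t₀ ≤ 1 / 4 := by
    rw [div_le_div_iff₀ ht₀ (by norm_num)]
    linarith
  have hle := hu.le_supersolution (T := t₀)
    (v := fun x t => (M - M / t₀ * t) + 1 / 4 * (1 - ‖x‖ ^ 2)) ?_ ?_ ?_ ?_ ?_
  · intro x hx
    have := hle x hx t₀ ⟨ht₀.le, le_rfl⟩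
    rw [div_mul_cancel₀ _ ht₀.ne'] at this
    linarith
  · exact Continuous.continuousOn (by fun_prop)
  · intro x hx
    have h1 := hu0 x hx
    rw [mem_closedBall_zero_iff] at hx
    have hs0 : 0 ≤ 1 - ‖x‖ ^ 2 := by nlinarith [norm_nonneg x]
    linarith
  · intro x hx t ht
    rw [mem_sphere_zero_iff_norm] at hx
    have h1 : M / t₀ * t ≤ M / t₀ * t₀ := mul_le_mul_of_nonneg_left ht.2 (by positivity)
    rw [div_mul_cancel₀ _ ht₀.ne'] at h1
    simp only [hx]
    linarith
  · intro x hx t _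
    exact radial_contDiffAt (g := fun s => (M - M / t₀ * t) + 1 / 4 * s)
      (fun s _ => by fun_prop) (mem_ball_zero_iff.1 hx)
  · intro x hx t _
    have hx1 : ‖x‖ < 1 := mem_ball_zero_iff.1 hx
    refine ⟨-(M / t₀), ?_, ?_⟩
    · have h1 : HasDerivAt (fun s : ℝ => M - M / t₀ * s) (-(M / t₀)) t := by
        simpa using ((hasDerivAt_id' t).const_mul (M / t₀)).const_sub M
      exact h1.add_const _
    · obtain ⟨hgrad, hlap⟩ := radial_calculus (n := n) (x := x)
        (g := fun s => (M - M / t₀ * t) + 1 / 4 * s) (g1 := fun _ => 1 / 4) (g2 := fun _ => 0)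
        (fun s _ => (((hasDerivAt_id' s).const_mul (1 / 4 : ℝ)).const_add (M - M / t₀ * t)).congr_deriv
          (mul_one _))
        (fun s _ => hasDerivAt_const _ _) hx1
      rw [hgrad.gradient, hlap, norm_smul, norm_neg, Real.norm_of_nonneg (by norm_num)]
      have hn' : (1 : ℝ) ≤ n := by exact_mod_cast hn
      have hpow : (2 * (1 / 4) * ‖x‖) ^ p ≤ (2 * (1 / 4) * ‖x‖) ^ (2 : ℝ) :=
        Real.rpow_le_rpow_of_exponent_ge' (by positivity) (by linarith) (by norm_num) hp.le
      have h2 : (2 * (1 / 4) * ‖x‖) ^ (2 : ℝ) = 1 / 4 * ‖x‖ ^ 2 := by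
        rw [Real.rpow_two]
        ring
      have h3 : ‖x‖ ^ 2 ≤ 1 := by nlinarith [norm_nonneg x]
      linarith

theorem memX_mul_one_sub_norm_sq {n : ℕ} {l : ℝ} (hl : 0 ≤ l) :
    MemX (ball (0 : Euc n) 1) fun x => l * (1 - ‖x‖ ^ 2) := by
  refine ⟨?_, fun x hx => ?_, fun x hx => ?_⟩
  · have : ContDiff ℝ 1 fun x : Euc n => ‖x‖ ^ 2 := contDiff_norm_sq ℝ
    exact ContDiff.contDiffOn (by fun_prop)
  · rw [closure_ball 0 one_ne_zero, mem_closedBall_zero_iff] at hx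
    have hs0 : 0 ≤ 1 - ‖x‖ ^ 2 := by nlinarith [norm_nonneg x]
    positivity
  · rw [frontier_ball 0 one_ne_zero, mem_sphere_zero_iff_norm] at hx
    simp [hx]

/-- The supremum of regularized solutions tends to zero at a boundary point as soon as it is
dominated by continuous functions with arbitrarily small value at this point. -/
theorem tendsto_Usup_zero {n : ℕ} {p : ℝ} {u0 : Euc n → ℝ} {u : ℕ → Euc n → ℝ → ℝ}
    (hu : ∀ j, 1 ≤ j → IsRegSol n p (ball (0 : Euc n) 1) j u0 (u j)) {t : ℝ} (ht : 0 < t)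
    {x₀ : Euc n} (hx₀ : x₀ ∈ sphere 0 1)
    (hv : ∀ ε > 0, ∃ v : Euc n → ℝ, ContinuousOn v (closedBall 0 1) ∧ v x₀ < ε ∧
      ∀ x ∈ ball (0 : Euc n) 1, ∀ j, 1 ≤ j → u j x t ≤ v x) :
    Tendsto (fun x => Usup u x t) (𝓝[ball 0 1] x₀) (𝓝 0) := by
  have : Nonempty {j : ℕ // 1 ≤ j} := ⟨⟨1, le_rfl⟩⟩
  rw [tendsto_order]
  constructor
  · intro a ha
    filter_upwards [self_mem_nhdsWithin] with x hx
    exact ha.trans_le (Real.iSup_nonneg fun j =>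
      (hu j.1 j.2).nonneg x (subset_closure hx) t ht.le)
  · intro a ha
    obtain ⟨v, hvc, hvx, hle⟩ := hv a ha
    have h1 : ∀ᶠ x in 𝓝[ball 0 1] x₀, v x < a :=
      ((hvc x₀ (sphere_subset_closedBall hx₀)).mono ball_subset_closedBall).eventually_lt_const hvx
    filter_upwards [h1, self_mem_nhdsWithin] with x hxa hx
    exact (ciSup_le fun j : {j : ℕ // 1 ≤ j} => hle x hx j.1 j.2).trans_lt hxa

/-- **Theorem 2 of Porretta–Souplet.** For the unit ball `Ω ⊂ ℝⁿ` and `p > 2`, there exists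
`u₀ ∈ X` such that (a) no global classical solution with data `u₀` exists (gradient blowup
occurs in finite time), and (b) the global viscosity solution with data `u₀` never loses the
boundary conditions: it tends to `0` at every boundary point, for every time `t > 0`. -/
theorem gradient_blowup_without_loss_of_bc (n : ℕ) (hn : 1 ≤ n) (p : ℝ) (hp : 2 < p) :
    ∃ u0 : Euc n → ℝ, MemX (ball (0 : Euc n) 1) u0 ∧
      (¬ ∃ u : Euc n → ℝ → ℝ, IsClassicalSol n p (ball (0 : Euc n) 1) u0 u ⊤) ∧
      ∀ u : ℕ → Euc n → ℝ → ℝ,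
        (∀ j, 1 ≤ j → IsRegSol n p (ball (0 : Euc n) 1) j u0 (u j)) →
          ∀ x₀ ∈ frontier (ball (0 : Euc n) 1), ∀ t > (0:ℝ),
            Tendsto (fun x => Usup u x t) (nhdsWithin x₀ (ball (0 : Euc n) 1)) (nhds 0) := by
  by_contra hcon
  have H : ∀ l : ℝ, 0 ≤ l → (∀ ε > 0, ∀ t > 0, ∃ v : Euc n → ℝ, ContinuousOn v (closedBall 0 1) ∧
      (∀ x ∈ sphere (0 : Euc n) 1, v x < ε) ∧ ∀ j (u : Euc n → ℝ → ℝ),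
        IsRegSol n p (ball 0 1) j (fun x => l * (1 - ‖x‖ ^ 2)) u →
          ∀ x ∈ ball (0 : Euc n) 1, u x t ≤ v x) →
      ∃ u, IsClassicalSol n p (ball 0 1) (fun x : Euc n => l * (1 - ‖x‖ ^ 2)) u ⊤ := by
    intro l hl hv
    by_contra hno
    refine hcon ⟨_, memX_mul_one_sub_norm_sq hl, hno, fun u hu x₀ hx₀ t ht => ?_⟩
    rw [frontier_ball 0 one_ne_zero] at hx₀
    refine tendsto_Usup_zero hu ht hx₀ fun ε hε => ?_
    obtain ⟨v, hvc, hvb, hle⟩ := hv ε hε t ht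
    exact ⟨v, hvc, hvb x₀ hx₀, fun x hx j hj => hle j (u j) (hu j hj) x hx⟩
  set S : Set ℝ := {l | 0 ≤ l ∧
    ∃ u, IsClassicalSol n p (ball 0 1) (fun x : Euc n => l * (1 - ‖x‖ ^ 2)) u ⊤} with hS
  have hs : ∀ x ∈ closedBall (0 : Euc n) 1, 0 ≤ 1 - ‖x‖ ^ 2 ∧ 1 - ‖x‖ ^ 2 ≤ 1 := fun x hx => by
    rw [mem_closedBall_zero_iff] at hx
    constructor <;> nlinarith [norm_nonneg x]
  have hbarrier : ContinuousOn (fun x : Euc n => 1 / 4 * (1 - ‖x‖ ^ 2)) (closedBall 0 1) :=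
    Continuous.continuousOn (by fun_prop)
  have hbarrier0 : ∀ ε > 0, ∀ x ∈ sphere (0 : Euc n) 1, 1 / 4 * (1 - ‖x‖ ^ 2) < ε := by
    intro ε hε x hx
    rw [mem_sphere_zero_iff_norm] at hx
    simpa [hx] using hε
  have h0 : (0 : ℝ) ∈ S := by
    refine ⟨le_rfl, H 0 le_rfl fun ε hε t ht => ⟨_, hbarrier, hbarrier0 ε hε, ?_⟩⟩
    intro j u hu x hx
    exact hu.le_barrier hn hp le_rfl (by simp) ht (by linarith) x (ball_subset_closedBall hx)
  have hbdd : BddAbove S := by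
    obtain ⟨Λ, hΛ⟩ := exists_forall_not_isClassicalSol n hn hp
    refine ⟨Λ, fun l hl => ?_⟩
    by_contra! hlt
    obtain ⟨u, hu⟩ := hl.2
    exact hΛ l hlt.le u hu
  set m := sSup S with hm
  have hm0 : 0 ≤ m := le_csSup hbdd h0
  obtain ⟨U, hU⟩ : ∃ u, IsClassicalSol n p (ball 0 1) (fun x : Euc n => m * (1 - ‖x‖ ^ 2)) u ⊤ := by
    refine H m hm0 fun ε hε t ht => ?_
    obtain ⟨l, ⟨_, u, hu⟩, hlm⟩ := exists_lt_of_lt_csSup ⟨0, h0⟩ (sub_lt_self m hε)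
    have hle : l ≤ m := le_csSup hbdd ⟨‹_›, u, hu⟩
    have hcont := (hu.continuousOn_closedBall t).add
      (continuousOn_const (c := m - l))
    refine ⟨fun x => u x t + (m - l), ?_, fun x hx => ?_, fun j w hw x hx => ?_⟩
    · exact hcont.comp (f := fun x : Euc n => (x, t)) (by fun_prop) fun y hy => ⟨hy, ht.le, le_rfl⟩
    · simp only [hu.eq_zero_of_mem_sphere hx ht.le]
      linarith
    · refine hw.le_supersolution (T := t) (v := fun x t => u x t + (m - l)) hcont ?_ ?_ ?_ ?_ x
        (ball_subset_closedBall hx) t ⟨ht.le, le_rfl⟩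
      · intro y hy
        have h1 := hu.ic y (by rwa [closure_ball 0 one_ne_zero])
        have h2 := mul_le_mul_of_nonneg_left (hs y hy).2 (sub_nonneg.2 hle)
        simp only [h1]
        linarith
      · intro y hy s hs
        rw [hu.eq_zero_of_mem_sphere hy hs.1.le]
        linarith
      · exact fun y hy s hs => (hu.contDiffAt hy hs.1).add contDiffAt_const
      · intro y hy s hs
        refine ⟨_, (hu.hasDerivAt hy hs.1).add_const _, le_of_eq ?_⟩
        rw [lap_add (hu.contDiffAt hy hs.1) contDiffAt_const,
          gradient_fun_add' ((hu.contDiffAt hy hs.1).differentiableAt (by norm_num))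
            (differentiableAt_const _), gradient_fun_const]
        simp [lap]
  obtain ⟨h, hh2, hhb, ⟨ε, hε, hεh⟩, hsuper⟩ := hU.exists_supersolution_add hn hp (4 * (m + 1))
  set l := m + min ε 1 with hl
  have hmin : 0 < min ε 1 := lt_min hε one_pos
  have hl0 : 0 ≤ l := by positivity
  have hlS : l ∈ S := by
    refine ⟨hl0, H l hl0 fun η hη t ht => ?_⟩
    rcases le_total t (4 * (m + 1)) with htT | htT
    · have hcont : ContinuousOn (fun q : Euc n × ℝ => U q.1 q.2 + h q.1)
          (closedBall 0 1 ×ˢ Icc 0 t) :=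
        (hU.continuousOn_closedBall t).add (hh2.continuous.comp continuous_fst).continuousOn
      refine ⟨fun x => U x t + h x, ?_, fun x hx => ?_, fun j w hw x hx => ?_⟩
      · exact hcont.comp (f := fun x : Euc n => (x, t)) (by fun_prop)
          fun y hy => ⟨hy, ht.le, le_rfl⟩
      · simp only [hU.eq_zero_of_mem_sphere hx ht.le, hhb x hx]
        linarith
      · refine hw.le_supersolution (T := t) (v := fun x t => U x t + h x) hcont ?_ ?_ ?_ ?_ x
          (ball_subset_closedBall hx) t ⟨ht.le, le_rfl⟩
        · intro y hy
          have h1 := hU.ic y (by rwa [closure_ball 0 one_ne_zero])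
          have h2 := mul_le_mul_of_nonneg_right (min_le_left ε 1) (hs y hy).1
          have h3 := hεh y hy
          simp only [h1, hl]
          linarith
        · intro y hy s hs
          rw [hU.eq_zero_of_mem_sphere hy hs.1.le, hhb y hy]
          simp
        · exact fun y hy s hs => (hU.contDiffAt hy hs.1).add hh2.contDiffAt
        · exact fun y hy s hs => ⟨_, (hU.hasDerivAt hy hs.1).add_const _,
            hsuper y hy s ⟨hs.1, hs.2.trans htT⟩⟩
    · refine ⟨_, hbarrier, hbarrier0 η hη, fun j w hw x hx => ?_⟩
      refine hw.le_barrier hn hp (M := m + 1) (by positivity) (fun y hy => ?_) ht htT x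
        (ball_subset_closedBall hx)
      have h1 := mul_le_mul_of_nonneg_left (hs y hy).2 hl0
      have h2 := min_le_right ε 1
      linarith
  have := le_csSup hbdd hlS
  linarith

end
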